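/- (Ascent direction.) In the setting of the prediction step, suppose additionally that ‖H⁻¹ξ‖_H ≤ η‖u − ũ‖_H with 0 < η < 1, that u* solves VI(Ω,F), and that F is monotone. Then (u − u*)ᵀ d(u,ũ,ξ) ≥ (1 − η)‖u − ũ‖²_H; in particular, if u ≠ ũ then d(u,ũ,ξ) forms an ascent direction for ½‖·−u*‖² at u. -/

import Mathlib

open Matrix

/-- For `H` positive definite and `0 < η`, if `ξᵀH⁻¹ξ ≤ η² vᵀHv` then `vᵀξ ≤ η vᵀHv`. -/
theorem Matrix.PosDef.dotProduct_le_of_inv_le {n : Type*} [Fintype n] [DecidableEq n]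
    {H : Matrix n n ℝ} (hH : H.PosDef) {η : ℝ} (hη : 0 < η) {v ξ : n → ℝ}
    (h : ξ ⬝ᵥ H⁻¹.mulVec ξ ≤ η ^ 2 * (v ⬝ᵥ H.mulVec v)) :
    v ⬝ᵥ ξ ≤ η * (v ⬝ᵥ H.mulVec v) := by
  obtain ⟨y, rfl⟩ : ∃ y, ξ = H.mulVec y :=
    ⟨H⁻¹.mulVec ξ, by
      rw [mulVec_mulVec, mul_nonsing_inv _ ((isUnit_iff_isUnit_det _).mp hH.isUnit), one_mulVec]⟩
  rw [mulVec_mulVec, nonsing_inv_mul _ ((isUnit_iff_isUnit_det _).mp hH.isUnit), one_mulVec,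
    dotProduct_comm (H.mulVec y)] at h
  have hsymm : y ⬝ᵥ H.mulVec v = v ⬝ᵥ H.mulVec y := by
    have hT : Hᵀ = H := by simpa using hH.isHermitian.eq
    rw [dotProduct_mulVec, ← mulVec_transpose, hT, dotProduct_comm]
  have hnonneg := hH.posSemidef.dotProduct_mulVec_nonneg (η • v - y)
  simp only [star_trivial, mulVec_sub, mulVec_smul, sub_dotProduct, dotProduct_sub,
    smul_dotProduct, dotProduct_smul, smul_eq_mul, hsymm] at hnonneg
  refine le_of_mul_le_mul_left ?_ hη
  linarith

/-- Ascent direction: under the criterion `‖H⁻¹ξ‖_H ≤ η‖u - ũ‖_H` (`0 < η < 1`), if `ũ` is a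
predictor satisfying `(w - ũ)ᵀF(ũ) ≥ (w - ũ)ᵀd` for all `w ∈ Ω` with `d = H(u - ũ) - ξ`, `F`
monotone on `Ω`, and `u*` solves `VI(Ω,F)`, then `(u - u*)ᵀd ≥ (1 - η)‖u - ũ‖²_H`; in
particular `d` is an ascent direction of `½‖· - u*‖²` at `u` when `u ≠ ũ`. -/
theorem ppcm_ascent_direction
    (N : ℕ) (Ω : Set (Fin N → ℝ)) (hclosed : IsClosed Ω) (hconv : Convex ℝ Ω)
    (F : (Fin N → ℝ) → (Fin N → ℝ))
    (hFmono : ∀ a ∈ Ω, ∀ c ∈ Ω, (0 : ℝ) ≤ (a - c) ⬝ᵥ (F a - F c))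
    (H : Matrix (Fin N) (Fin N) ℝ) (hH : H.PosDef)
    (η : ℝ) (hη0 : 0 < η) (hη1 : η < 1)
    (u ut ξ : Fin N → ℝ) (hu : u ∈ Ω) (hut : ut ∈ Ω)
    (d : Fin N → ℝ) (hd : d = H.mulVec (u - ut) - ξ)
    (hpred : ∀ w ∈ Ω, (w - ut) ⬝ᵥ F ut ≥ (w - ut) ⬝ᵥ d)
    (hcrit : Real.sqrt (ξ ⬝ᵥ H⁻¹.mulVec ξ) ≤ η * Real.sqrt ((u - ut) ⬝ᵥ H.mulVec (u - ut)))
    (ustar : Fin N → ℝ) (hustar : ustar ∈ Ω)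
    (hVI : ∀ w ∈ Ω, (0 : ℝ) ≤ (w - ustar) ⬝ᵥ F ustar) :
    (u - ustar) ⬝ᵥ d ≥ (1 - η) * ((u - ut) ⬝ᵥ H.mulVec (u - ut))
      ∧ (u ≠ ut → (0 : ℝ) < (u - ustar) ⬝ᵥ d) := by
  have hpos : u ≠ ut → 0 < (u - ut) ⬝ᵥ H.mulVec (u - ut) := fun hne => by
    simpa using hH.dotProduct_mulVec_pos (sub_ne_zero.mpr hne)
  have hnonneg : 0 ≤ (u - ut) ⬝ᵥ H.mulVec (u - ut) := by
    simpa using hH.posSemidef.dotProduct_mulVec_nonneg (u - ut)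
  have hcrit_sq : ξ ⬝ᵥ H⁻¹.mulVec ξ ≤ η ^ 2 * ((u - ut) ⬝ᵥ H.mulVec (u - ut)) := by
    have h := (Real.sqrt_le_left (by positivity)).mp hcrit
    rwa [mul_pow, Real.sq_sqrt hnonneg] at h
  have hξ := hH.dotProduct_le_of_inv_le hη0 hcrit_sq
  have hmono := hFmono ut hut ustar hustar
  have hsol := hVI ut hut
  have hpred_star := hpred ustar hustar
  have hsplit : (u - ut) ⬝ᵥ d = (u - ut) ⬝ᵥ H.mulVec (u - ut) - (u - ut) ⬝ᵥ ξ := by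
    rw [hd, dotProduct_sub]
  have hmain : (u - ustar) ⬝ᵥ d ≥ (1 - η) * ((u - ut) ⬝ᵥ H.mulVec (u - ut)) := by
    have hstar : 0 ≤ (ut - ustar) ⬝ᵥ d := by
      simp only [sub_dotProduct, dotProduct_sub] at hmono hsol hpred_star ⊢
      linarith
    rw [← sub_add_sub_cancel u ut ustar, add_dotProduct]
    linarith
  exact ⟨hmain, fun hne => (mul_pos (sub_pos.mpr hη1) (hpos hne)).trans_le hmain⟩
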